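/- There is no C² function k : (0, ∞) → (0, 1) with k'(r) > 0 for all r ∈ (0, ∞), lim_{r→0⁺} k(r) = 0, lim_{r→∞} k(r) = 1, satisfying k''(r) + k'(r)/r − k(r)/r² + (2·k(r)/(1 − k(r)²)) · ( k'(r)² − k(r)²/r² ) = 0 for all r ∈ (0, ∞). -/

import Mathlib

open Real Set Filter Topology

/-- The conserved quantity of the rotationally symmetric harmonic map equation. -/
lemma hasDerivAt_energy {k : ℝ → ℝ} {r q : ℝ} (hr : 0 < r) (hk : k r ∈ Ioo (0 : ℝ) 1)
    (hd : HasDerivAt k (deriv k r) r) (hdd : HasDerivAt (deriv k) q r)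
    (ode : q + deriv k r / r - k r / r ^ 2 +
      2 * k r / (1 - (k r) ^ 2) * ((deriv k r) ^ 2 - (k r) ^ 2 / r ^ 2) = 0) :
    HasDerivAt (fun s ↦ (s ^ 2 * deriv k s ^ 2 - k s ^ 2) / (1 - k s ^ 2) ^ 2) 0 r := by
  have hD : 1 - k r ^ 2 ≠ 0 := by nlinarith [hk.1, hk.2]
  have h := ((((hasDerivAt_id r).pow 2).mul (hdd.pow 2)).sub (hd.pow 2)).div
    (((hd.pow 2).const_sub 1).pow 2) (pow_ne_zero 2 hD)
  refine h.congr_deriv ?_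
  have hq : q = -(deriv k r / r) + k r / r ^ 2 -
      2 * k r / (1 - (k r) ^ 2) * ((deriv k r) ^ 2 - (k r) ^ 2 / r ^ 2) := by linarith
  subst hq
  simp [hD]
  field_simp
  ring

theorem stmt_10 :
    ¬ ∃ k : ℝ → ℝ,
      ContDiffOn ℝ 2 k (Ioi 0) ∧
      (∀ r ∈ Ioi (0:ℝ), k r ∈ Ioo (0:ℝ) 1) ∧
      (∀ r ∈ Ioi (0:ℝ), 0 < deriv k r) ∧
      Tendsto k (𝓝[>] (0:ℝ)) (𝓝 0) ∧
      Tendsto k atTop (𝓝 1) ∧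
      (∀ r ∈ Ioi (0:ℝ),
        deriv (deriv k) r + deriv k r / r - k r / r ^ 2 +
          2 * k r / (1 - (k r) ^ 2) * ((deriv k r) ^ 2 - (k r) ^ 2 / r ^ 2) = 0) := by
  rintro ⟨k, hC, hk, hpos, h0, -, ode⟩
  have hd : ∀ r ∈ Ioi (0 : ℝ), HasDerivAt k (deriv k r) r := fun r hr ↦
    ((hC.differentiableOn (by norm_num)).differentiableAt (Ioi_mem_nhds hr)).hasDerivAt
  have hC' : ContDiffOn ℝ 1 (deriv k) (Ioi 0) :=
    hC.deriv_of_isOpen isOpen_Ioi (by norm_num)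
  have hdd : ∀ r ∈ Ioi (0 : ℝ), HasDerivAt (deriv k) (deriv (deriv k) r) r := fun r hr ↦
    ((hC'.differentiableOn (by norm_num)).differentiableAt (Ioi_mem_nhds hr)).hasDerivAt
  have hE := fun r hr ↦ hasDerivAt_energy hr (hk r hr) (hd r hr) (hdd r hr) (ode r hr)
  obtain ⟨c, hc⟩ := isOpen_Ioi.exists_is_const_of_deriv_eq_zero
    (convex_Ioi (0 : ℝ)).isPreconnected
    (fun r hr ↦ (hE r hr).differentiableAt.differentiableWithinAt)
    (fun r hr ↦ (hE r hr).deriv)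
  have hN : ∀ r ∈ Ioi (0 : ℝ), r ^ 2 * deriv k r ^ 2 - k r ^ 2 = c * (1 - k r ^ 2) ^ 2 := by
    intro r hr
    have hD : 1 - k r ^ 2 ≠ 0 := by nlinarith [(hk r hr).1, (hk r hr).2]
    exact (div_eq_iff (pow_ne_zero 2 hD)).1 (hc r hr)
  -- Letting `r → 0` shows that the conserved quantity is nonnegative.
  have hc0 : 0 ≤ c := by
    have hlim : Tendsto (fun r ↦ k r ^ 2 + c * (1 - k r ^ 2) ^ 2) (𝓝[>] (0 : ℝ)) (𝓝 c) := by
      simpa using (h0.pow 2).add ((((h0.pow 2).const_sub 1).pow 2).const_mul c)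
    refine ge_of_tendsto hlim ?_
    filter_upwards [self_mem_nhdsWithin] with r hr
    nlinarith [hN r hr, sq_nonneg (r * deriv k r)]
  have hge : ∀ r ∈ Ioi (0 : ℝ), k r ≤ r * deriv k r := by
    intro r hr
    refine (sq_le_sq₀ (hk r hr).1.le (mul_pos hr (hpos r hr)).le).1 ?_
    nlinarith [hN r hr, mul_nonneg hc0 (sq_nonneg (1 - k r ^ 2))]
  have hmono : MonotoneOn (fun r ↦ k r / r) (Ioi 0) := by
    have hq : ∀ r ∈ Ioi (0 : ℝ), HasDerivAt (fun r ↦ k r / r) _ r := fun r hr ↦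
      (hd r hr).div (hasDerivAt_id r) (ne_of_gt hr)
    refine monotoneOn_of_deriv_nonneg (convex_Ioi 0)
      (fun r hr ↦ (hq r hr).continuousAt.continuousWithinAt) ?_ ?_ <;> rw [interior_Ioi]
    · exact fun r hr ↦ (hq r hr).differentiableAt.differentiableWithinAt
    · intro r hr
      rw [(hq r hr).deriv]
      refine div_nonneg ?_ (sq_nonneg _)
      simpa [mul_comm] using hge r hr
  have h1 := hk 1 (mem_Ioi.2 one_pos)
  have hinv : 0 < (k 1)⁻¹ := inv_pos.2 h1.1
  have h := hmono (mem_Ioi.2 one_pos) (mem_Ioi.2 hinv) ((one_le_inv₀ h1.1).2 h1.2.le)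
  have h2 := (hk _ (mem_Ioi.2 hinv)).2
  simp only [div_one, div_inv_eq_mul] at h
  nlinarith [h1.1]
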